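/- If (s*, y*) ∈ Ŝ maximizes Σ_{i=1}^n y_i over Ŝ, then y_i* = u_i(s*) for every player i, and s* maximizes the social welfare Σ_{i=1}^n u_i(s) over S. -/

import Mathlib

open Finset

/-- A function on a finite linear order has a first maximizer. -/
theorem exists_first_argmax {K : Type*} [Fintype K] [Nonempty K] [LinearOrder K] (f : K → ℤ) :
    ∃ k, (∀ j, k < j → f j ≤ f k) ∧ ∀ j, j < k → f j < f k := by
  obtain ⟨m, hm⟩ := Finite.exists_max f
  obtain ⟨k, hk, hmin⟩ := (univ.filter fun k => f k = f m).exists_minimal ⟨m, by simp⟩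
  simp only [mem_filter, mem_univ, true_and] at hk hmin
  refine ⟨k, fun j _ => hk ▸ hm j, fun j hj => ?_⟩
  refine lt_of_le_of_ne (hk ▸ hm j) fun h => ?_
  exact absurd (hmin (h.trans hk) hj.le) (not_le.mpr hj)

/-- A first maximizer attains the supremum. -/
theorem sup'_eq_of_first_argmax {K : Type*} [Fintype K] [Nonempty K] [LinearOrder K] {f : K → ℤ}
    {k : K} (h₁ : ∀ j, k < j → f j ≤ f k) (h₂ : ∀ j, j < k → f j < f k) :
    univ.sup' univ_nonempty f = f k := by
  refine le_antisymm (sup'_le _ _ fun j _ => ?_) (le_sup' f (mem_univ k))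
  rcases lt_trichotomy j k with h | rfl | h
  exacts [(h₂ j h).le, le_rfl, h₁ j h]

theorem stmt14
    {n : ℕ} {d : Fin n → ℕ}
    (Si : ∀ i, Set (Fin (d i) → ℤ))
    (hSfin : ∀ i, (Si i).Finite) (hSne : ∀ i, (Si i).Nonempty)
    {K L : Fin n → Type*}
    [∀ i, Fintype (K i)] [∀ i, Nonempty (K i)] [∀ i, LinearOrder (K i)]
    [∀ i, Fintype (L i)] [∀ i, Nonempty (L i)]
    (f : ∀ i, K i → (∀ j, Fin (d j) → ℤ) → ℤ)
    (g : ∀ i, L i → (∀ j, Fin (d j) → ℤ) → ℤ)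
    (hf : ∀ i k, ∃ (α : ∀ j, Fin (d j) → ℤ) (β : ℤ),
        ∀ s, f i k s = (∑ j, ∑ t, α j t * s j t) + β)
    (hg : ∀ i l, ∃ (γ : ∀ j, Fin (d j) → ℤ) (δ : ℤ),
        ∀ s, g i l s = (∑ j, ∑ t, γ j t * s j t) + δ)
    (S : Set (∀ j, Fin (d j) → ℤ)) (hS : S = Set.pi Set.univ Si)
    (u : ∀ i, (∀ j, Fin (d j) → ℤ) → ℤ)
    (hu : ∀ i s, u i s = (univ.sup' univ_nonempty fun k => f i k s)
        - (univ.sup' univ_nonempty fun l => g i l s))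
    (Sik : ∀ i, K i → Set (∀ j, Fin (d j) → ℤ))
    (hSik : ∀ i k, Sik i k = {s ∈ S |
        (∀ j, k < j → f i j s ≤ f i k s) ∧ (∀ j, j < k → f i j s < f i k s)})
    (Sk : (∀ i, K i) → Set (∀ j, Fin (d j) → ℤ))
    (hSk : ∀ k, Sk k = ⋂ i, Sik i (k i))
    (hpos : ∀ i, ∀ s ∈ S, 0 ≤ u i s)
    (Shatk : (∀ i, K i) → Set ((∀ j, Fin (d j) → ℤ) × (Fin n → ℤ)))
    (hShatk : ∀ k, Shatk k = {p | p.1 ∈ Sk k ∧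
        ∀ i, 0 ≤ p.2 i ∧ ∀ l : L i, p.2 i ≤ f i (k i) p.1 - g i l p.1})
    (Shat : Set ((∀ j, Fin (d j) → ℤ) × (Fin n → ℤ)))
    (hShat : Shat = ⋃ k, Shatk k)
    (sstar : ∀ j, Fin (d j) → ℤ) (ystar : Fin n → ℤ)
    (hmem : (sstar, ystar) ∈ Shat)
    (hopt : ∀ p ∈ Shat, ∑ i, p.2 i ≤ ∑ i, ystar i)
    :
    (∀ i, ystar i = u i sstar) ∧ ∀ s ∈ S, ∑ i, u i s ≤ ∑ i, u i sstar := by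
  subst hShat
  have le_u : ∀ i, ystar i ≤ u i sstar ∧ sstar ∈ S := by
    intro i
    obtain ⟨k, hk⟩ := Set.mem_iUnion.1 hmem
    rw [hShatk, Set.mem_ofPred_eq, hSk, Set.mem_iInter] at hk
    have hi := hk.1 i
    rw [hSik] at hi
    obtain ⟨hs, h₁, h₂⟩ := hi
    obtain ⟨l, -, hl⟩ := exists_mem_eq_sup' univ_nonempty fun l => g i l sstar
    refine ⟨?_, hs⟩
    rw [hu, hl, sup'_eq_of_first_argmax (f := fun k => f i k sstar) h₁ h₂]
    exact (hk.2 i).2 l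
  have u_mem : ∀ s ∈ S, (s, fun i => u i s) ∈ ⋃ k, Shatk k := by
    intro s hs
    choose k h₁ h₂ using fun i => exists_first_argmax fun k => f i k s
    refine Set.mem_iUnion.2 ⟨k, ?_⟩
    rw [hShatk, Set.mem_ofPred_eq, hSk, Set.mem_iInter]
    refine ⟨fun i => ?_, fun i => ⟨hpos i s hs, fun l => ?_⟩⟩
    · rw [hSik]
      exact ⟨hs, h₁ i, h₂ i⟩
    · change u i s ≤ _
      rw [hu, sup'_eq_of_first_argmax (h₁ i) (h₂ i)]
      exact sub_le_sub_left (le_sup' (fun l => g i l s) (mem_univ l)) _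
  refine ⟨fun i => ?_, fun s hs =>
    (hopt _ (u_mem s hs)).trans (sum_le_sum fun i _ => (le_u i).1)⟩
  have hsum : ∑ i, ystar i = ∑ i, u i sstar :=
    le_antisymm (sum_le_sum fun i _ => (le_u i).1) (hopt _ (u_mem sstar (le_u i).2))
  exact (sum_eq_sum_iff_of_le fun i _ => (le_u i).1).1 hsum i (mem_univ i)
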